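/- arXiv:2205.05992 — 2 statements merged into one kernel-verified Lean document; each statement's English description precedes it below -/
import Mathlib

section
/- Let F be a polynomial Euler product of degree d, φ(n,F) = n∏_{p|n}F_p(1)^{-1}, and C(F) = (1/2)∏_p(1 - γ(p)/p²) with γ(p) = p(1 - 1/F_p(1)). Then for all x ≥ 1, ∑_{n ≤ x} φ(n,F) = C(F)·x² + O(x·(log 2x)^d). -/
open Filter Topology Classical

/-- `γ(p) = p(1 - 1/F_p(1))` where `F_p(1)⁻¹ = ∏_j (1 - α_j(p)/p)` is the inverse of the
local Euler factor at `p` evaluated at `s = 1`. -/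
noncomputable def gammaF {d : ℕ} (a : ℕ → Fin d → ℂ) (p : ℕ) : ℂ :=
  (p : ℂ) * (1 - ∏ j : Fin d, (1 - a p j / (p : ℂ)))

/-- `α(n) = μ(n) ∏_{p|n} γ(p)`. -/
noncomputable def alphaF {d : ℕ} (a : ℕ → Fin d → ℂ) (n : ℕ) : ℂ :=
  ((ArithmeticFunction.moebius n : ℤ) : ℂ) * ∏ p ∈ n.primeFactors, gammaF a p

/-- The associated Euler totient function `φ(n,F) = n ∏_{p|n} F_p(1)⁻¹`. -/
noncomputable def phiF {d : ℕ} (a : ℕ → Fin d → ℂ) (n : ℕ) : ℂ :=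
  (n : ℂ) * ∏ p ∈ n.primeFactors, ∏ j : Fin d, (1 - a p j / (p : ℂ))

lemma one_add_pow_le_quadratic (d : ℕ) {t : ℝ} (h0 : 0 ≤ t) (h1 : t ≤ 1) :
    (1 + t) ^ d ≤ 1 + d * t + 3 ^ d * t ^ 2 := by
  induction d with
  | zero => norm_num; positivity
  | succ d ih =>
    have hd : (d : ℝ) ≤ 3 ^ d := by exact_mod_cast (Nat.lt_pow_self (by norm_num)).le
    have h2 : t ^ 3 ≤ t ^ 2 := pow_le_pow_of_le_one h0 h1 (by norm_num)
    calc (1 + t) ^ (d + 1) = (1 + t) ^ d * (1 + t) := pow_succ _ _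
      _ ≤ (1 + d * t + 3 ^ d * t ^ 2) * (1 + t) := by gcongr
      _ = 1 + (d + 1) * t + d * t ^ 2 + 3 ^ d * t ^ 2 + 3 ^ d * t ^ 3 := by ring
      _ ≤ 1 + (d + 1) * t + 3 ^ d * t ^ 2 + 3 ^ d * t ^ 2 + 3 ^ d * t ^ 2 := by gcongr
      _ = _ := by push_cast; ring

lemma norm_one_sub_prod_one_sub_le {ι : Type*} (s : Finset ι) (z : ι → ℂ) {t : ℝ}
    (hz : ∀ i ∈ s, ‖z i‖ ≤ t) (ht : 0 ≤ t) :
    ‖1 - ∏ i ∈ s, (1 - z i)‖ ≤ (1 + t) ^ s.card - 1 := by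
  induction s using Finset.induction_on with
  | empty => simp
  | insert i s hi ih =>
    have h1 := ih fun j hj => hz j (Finset.mem_insert_of_mem hj)
    have h2 := hz i (Finset.mem_insert_self _ _)
    rw [Finset.prod_insert hi, Finset.card_insert_of_notMem hi]
    have h3 : ‖1 - z i‖ ≤ 1 + t := (norm_sub_le _ _).trans (by simpa using h2)
    calc ‖1 - (1 - z i) * ∏ j ∈ s, (1 - z j)‖
        = ‖z i + (1 - z i) * (1 - ∏ j ∈ s, (1 - z j))‖ := by congr 1; ring
      _ ≤ ‖z i‖ + ‖1 - z i‖ * ‖1 - ∏ j ∈ s, (1 - z j)‖ := by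
        rw [← norm_mul]; exact norm_add_le _ _
      _ ≤ t + (1 + t) * ((1 + t) ^ s.card - 1) := by gcongr
      _ = _ := by ring

lemma norm_gammaF_div_le {d : ℕ} (a : ℕ → Fin d → ℂ)
    (ha : ∀ p : ℕ, p.Prime → ∀ j : Fin d, ‖a p j‖ ≤ 1) {p : ℕ} (hp : p.Prime) :
    ‖gammaF a p‖ / p ≤ d * (1 / p) + 3 ^ d * (1 / (p : ℝ) ^ 2) := by
  have hp0 : (0 : ℝ) < p := by exact_mod_cast hp.pos
  have hp1 : (1 : ℝ) ≤ p := by exact_mod_cast hp.one_le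
  have h := norm_one_sub_prod_one_sub_le Finset.univ (fun j => a p j / (p : ℂ)) (t := 1 / p)
    (fun j _ => by
      rw [norm_div, Complex.norm_natCast]
      gcongr
      exact ha p hp j) (by positivity)
  have h' := one_add_pow_le_quadratic d (t := 1 / (p : ℝ)) (by positivity)
    ((div_le_one hp0).2 hp1)
  rw [gammaF, norm_mul, Complex.norm_natCast, mul_div_cancel_left₀ _ hp0.ne']
  rw [Finset.card_univ, Fintype.card_fin] at h
  rw [div_pow, one_pow] at h'
  linarith

/-- The function `n ↦ n⁻ᵏ`. -/
noncomputable def invPow (k : ℕ) (hk : k ≠ 0) : ArithmeticFunction ℝ :=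
  ⟨fun n => 1 / (n : ℝ) ^ k, by simp [hk]⟩

lemma invPow_apply (k : ℕ) (hk : k ≠ 0) (n : ℕ) : invPow k hk n = 1 / (n : ℝ) ^ k := rfl

lemma invPow_isMultiplicative (k : ℕ) (hk : k ≠ 0) : (invPow k hk).IsMultiplicative := by
  refine ⟨by simp [invPow_apply], fun {m n} _ => ?_⟩
  simp only [invPow_apply]
  push_cast
  rw [mul_pow, one_div_mul_one_div]

namespace ArithmeticFunction

lemma mul_nonneg_of_nonneg {f g : ArithmeticFunction ℝ} (hf : ∀ n, 0 ≤ f n) (hg : ∀ n, 0 ≤ g n)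
    (n : ℕ) : 0 ≤ (f * g) n := by
  rw [mul_apply]
  exact Finset.sum_nonneg fun x _ => mul_nonneg (hf _) (hg _)

lemma pow_nonneg_of_nonneg {f : ArithmeticFunction ℝ} (hf : ∀ n, 0 ≤ f n) (k n : ℕ) :
    0 ≤ (f ^ k) n := by
  induction k generalizing n with
  | zero => rw [pow_zero, one_apply]; split_ifs <;> norm_num
  | succ k ih => rw [pow_succ]; exact mul_nonneg_of_nonneg ih hf n

lemma IsMultiplicative.npow {R : Type*} [CommSemiring R] {f : ArithmeticFunction R}
    (hf : f.IsMultiplicative) (k : ℕ) : (f ^ k).IsMultiplicative := by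
  induction k with
  | zero => rw [pow_zero]; exact isMultiplicative_one
  | succ k ih => rw [pow_succ]; exact ih.mul hf

lemma mul_apply_prime {R : Type*} [CommSemiring R] {f g : ArithmeticFunction R}
    (hf : f 1 = 1) (hg : g 1 = 1) {p : ℕ} (hp : p.Prime) : (f * g) p = f p + g p := by
  rw [mul_apply, Nat.sum_divisorsAntidiagonal (fun i j => f i * g j), hp.divisors,
    Finset.sum_pair hp.one_lt.ne]
  simp [hf, hg, Nat.div_self hp.pos, add_comm]

lemma npow_apply_prime {R : Type*} [CommSemiring R] {f : ArithmeticFunction R}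
    (hf : f.IsMultiplicative) {p : ℕ} (hp : p.Prime) (k : ℕ) : (f ^ k) p = k * f p := by
  induction k with
  | zero => simp [one_apply_ne hp.one_lt.ne']
  | succ k ih =>
    rw [pow_succ, mul_apply_prime (hf.npow k).map_one hf.map_one hp, ih]
    push_cast; ring

lemma sum_Ioc_mul_le {f g : ArithmeticFunction ℝ} (hf : ∀ n, 0 ≤ f n) (hg : ∀ n, 0 ≤ g n)
    (N : ℕ) :
    ∑ n ∈ Finset.Ioc 0 N, (f * g) n ≤ (∑ n ∈ Finset.Ioc 0 N, f n) * ∑ n ∈ Finset.Ioc 0 N, g n := by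
  rw [sum_Ioc_mul_eq_sum_prod_filter, Finset.sum_mul_sum, ← Finset.sum_product']
  exact Finset.sum_le_sum_of_subset_of_nonneg (Finset.filter_subset _ _)
    fun x _ _ => mul_nonneg (hf _) (hg _)

lemma sum_Ioc_pow_le {f : ArithmeticFunction ℝ} (hf : ∀ n, 0 ≤ f n) (k N : ℕ) :
    ∑ n ∈ Finset.Ioc 0 N, (f ^ k) n ≤ (∑ n ∈ Finset.Ioc 0 N, f n) ^ k := by
  induction k with
  | zero =>
    simp only [pow_zero, one_apply, Finset.sum_ite_eq']
    split_ifs <;> norm_num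
  | succ k ih =>
    rw [pow_succ, pow_succ]
    refine (sum_Ioc_mul_le (pow_nonneg_of_nonneg hf k) hf N).trans ?_
    have := Finset.sum_nonneg fun n (_ : n ∈ Finset.Ioc 0 N) => hf n
    gcongr

end ArithmeticFunction

lemma sum_Ioc_one_div_le {x : ℝ} (hx : 1 ≤ x) :
    ∑ n ∈ Finset.Ioc 0 ⌊x⌋₊, 1 / (n : ℝ) ^ 1 ≤ 3 * Real.log (2 * x) := by
  have h := harmonic_floor_le_one_add_log x hx
  rw [harmonic_eq_sum_Icc] at h
  push_cast at h
  have h2 : Real.log (2 * x) = Real.log 2 + Real.log x := Real.log_mul (by norm_num) (by positivity)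
  have h3 := Real.log_two_gt_d9
  have h4 := Real.log_nonneg hx
  have h5 : ∑ n ∈ Finset.Ioc 0 ⌊x⌋₊, 1 / (n : ℝ) ^ 1 = ∑ n ∈ Finset.Icc 1 ⌊x⌋₊, (n : ℝ)⁻¹ :=
    Finset.sum_congr rfl fun n _ => by simp
  rw [h5, h2]
  linarith

lemma sum_Ioc_one_div_sq_le (N : ℕ) :
    ∑ n ∈ Finset.Ioc 0 N, 1 / (n : ℝ) ^ 2 ≤ 2 := by
  have h := sum_Ioo_inv_sq_le (α := ℝ) 0 (N + 1)
  simp only [one_div]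
  norm_num at h
  exact h

/-- The arithmetic function underlying `alphaF`. -/
noncomputable def alphaArith {d : ℕ} (a : ℕ → Fin d → ℂ) : ArithmeticFunction ℂ :=
  ⟨alphaF a, by simp [alphaF]⟩

lemma alphaArith_apply {d : ℕ} (a : ℕ → Fin d → ℂ) (n : ℕ) : alphaArith a n = alphaF a n := rfl

lemma alphaArith_isMultiplicative {d : ℕ} (a : ℕ → Fin d → ℂ) :
    (alphaArith a).IsMultiplicative := by
  refine ⟨by simp [alphaArith_apply, alphaF], fun {m n} h => ?_⟩
  simp only [alphaArith_apply, alphaF]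
  rw [ArithmeticFunction.isMultiplicative_moebius.map_mul_of_coprime h,
    h.primeFactors_mul, Finset.prod_union h.disjoint_primeFactors]
  push_cast; ring

lemma alphaF_prime {d : ℕ} (a : ℕ → Fin d → ℂ) {p : ℕ} (hp : p.Prime) :
    alphaF a p = -gammaF a p := by
  simp [alphaF, ArithmeticFunction.moebius_apply_prime hp, hp.primeFactors]

lemma alphaF_prime_pow {d : ℕ} (a : ℕ → Fin d → ℂ) {p k : ℕ} (hp : p.Prime) (hk : 2 ≤ k) :
    alphaF a (p ^ k) = 0 := by
  rw [alphaF, ArithmeticFunction.moebius_apply_prime_pow hp (by omega), if_neg (by omega)]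
  simp

lemma norm_alphaF_div_le {d : ℕ} (a : ℕ → Fin d → ℂ)
    (ha : ∀ p : ℕ, p.Prime → ∀ j : Fin d, ‖a p j‖ ≤ 1) (n : ℕ) :
    ‖alphaF a n‖ / n ≤ (invPow 1 one_ne_zero ^ d * invPow 2 two_ne_zero ^ 3 ^ d) n := by
  set G := invPow 1 one_ne_zero ^ d * invPow 2 two_ne_zero ^ 3 ^ d with hG
  have h1 := (invPow_isMultiplicative 1 one_ne_zero).npow d
  have h2 := (invPow_isMultiplicative 2 two_ne_zero).npow (3 ^ d)
  have hpos : ∀ k hk n, 0 ≤ invPow k hk n := fun k hk n => by rw [invPow_apply]; positivity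
  by_cases hn : Squarefree n
  · rw [← (h1.mul h2).prod_primeFactors hn]
    have hA := (alphaArith_isMultiplicative a).prod_primeFactors hn
    rw [alphaArith_apply] at hA
    have hn' : (n : ℝ) = ∏ p ∈ n.primeFactors, (p : ℝ) := by
      rw [← Nat.cast_prod, Nat.prod_primeFactors_of_squarefree hn]
    rw [← hA, norm_prod, hn', ← Finset.prod_div_distrib]
    refine Finset.prod_le_prod (fun p _ => by positivity) fun p hp => ?_
    have hp := Nat.prime_of_mem_primeFactors hp
    rw [ArithmeticFunction.mul_apply_prime h1.map_one h2.map_one hp,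
      ArithmeticFunction.npow_apply_prime (invPow_isMultiplicative _ _) hp,
      ArithmeticFunction.npow_apply_prime (invPow_isMultiplicative _ _) hp,
      alphaArith_apply, alphaF_prime a hp, norm_neg, invPow_apply, invPow_apply, pow_one]
    exact_mod_cast norm_gammaF_div_le a ha hp
  · have : alphaF a n = 0 := by
      simp [alphaF, ArithmeticFunction.moebius_eq_zero_of_not_squarefree hn]
    rw [this, norm_zero, zero_div]
    exact ArithmeticFunction.mul_nonneg_of_nonneg
      (ArithmeticFunction.pow_nonneg_of_nonneg (hpos _ _) _)
      (ArithmeticFunction.pow_nonneg_of_nonneg (hpos _ _) _) n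

lemma sum_norm_alphaF_div_le {d : ℕ} (a : ℕ → Fin d → ℂ)
    (ha : ∀ p : ℕ, p.Prime → ∀ j : Fin d, ‖a p j‖ ≤ 1) {x : ℝ} (hx : 1 ≤ x) :
    ∑ n ∈ Finset.Ioc 0 ⌊x⌋₊, ‖alphaF a n‖ / n ≤
      3 ^ d * 2 ^ 3 ^ d * Real.log (2 * x) ^ d := by
  have hpos : ∀ k hk n, 0 ≤ invPow k hk n := fun k hk n => by rw [invPow_apply]; positivity
  have hlog : 0 ≤ Real.log (2 * x) := Real.log_nonneg (by linarith)
  calc _ ≤ ∑ n ∈ Finset.Ioc 0 ⌊x⌋₊, (invPow 1 one_ne_zero ^ d * invPow 2 two_ne_zero ^ 3 ^ d) n :=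
        Finset.sum_le_sum fun n _ => norm_alphaF_div_le a ha n
    _ ≤ (∑ n ∈ Finset.Ioc 0 ⌊x⌋₊, (invPow 1 one_ne_zero ^ d) n) *
          ∑ n ∈ Finset.Ioc 0 ⌊x⌋₊, (invPow 2 two_ne_zero ^ 3 ^ d) n :=
        ArithmeticFunction.sum_Ioc_mul_le
          (ArithmeticFunction.pow_nonneg_of_nonneg (hpos _ _) _)
          (ArithmeticFunction.pow_nonneg_of_nonneg (hpos _ _) _) _
    _ ≤ (3 * Real.log (2 * x)) ^ d * 2 ^ 3 ^ d := by
        gcongr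
        · exact Finset.sum_nonneg fun n _ => ArithmeticFunction.pow_nonneg_of_nonneg (hpos _ _) _ _
        · refine (ArithmeticFunction.sum_Ioc_pow_le (hpos _ _) _ _).trans ?_
          gcongr
          · exact Finset.sum_nonneg fun n _ => hpos _ _ _
          · exact sum_Ioc_one_div_le hx
        · refine (ArithmeticFunction.sum_Ioc_pow_le (hpos _ _) _ _).trans ?_
          gcongr
          · exact Finset.sum_nonneg fun n _ => hpos _ _ _
          · exact sum_Ioc_one_div_sq_le _
    _ = _ := by rw [mul_pow]; ring

lemma sum_dyadic_le {f : ℕ → ℝ} (hf : ∀ n, 0 ≤ f n) {C : ℝ} {d : ℕ}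
    (h : ∀ x : ℝ, 1 ≤ x → ∑ n ∈ Finset.Ioc 0 ⌊x⌋₊, f n ≤ C * Real.log (2 * x) ^ d) (hC : 0 ≤ C)
    {x : ℝ} (hx : 1 ≤ x) (N : ℕ) :
    ∑ n ∈ Finset.Ioc ⌊x⌋₊ ⌊x * 2 ^ N⌋₊, f n / n ≤
      C * Real.log (2 * x) ^ d / x * ∑ k ∈ Finset.range N, ((k : ℝ) + 2) ^ d / 2 ^ k := by
  induction N with
  | zero => simp
  | succ N ih =>
    have hx0 : 0 < x := by linarith
    have hlog : 0 ≤ Real.log (2 * x) := Real.log_nonneg (by linarith)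
    have hy : 1 ≤ x * 2 ^ N := one_le_mul_of_one_le_of_one_le hx (one_le_pow₀ (by norm_num))
    have hy2 : x * 2 ^ N ≤ x * 2 ^ (N + 1) := by
      rw [pow_succ]; nlinarith
    have hxy : x ≤ x * 2 ^ N := le_mul_of_one_le_right hx0.le (one_le_pow₀ (by norm_num))
    rw [← Finset.sum_Ioc_consecutive _ (Nat.floor_mono hxy) (Nat.floor_mono hy2),
      Finset.sum_range_succ, mul_add]
    refine add_le_add ih ?_
    calc ∑ n ∈ Finset.Ioc ⌊x * 2 ^ N⌋₊ ⌊x * 2 ^ (N + 1)⌋₊, f n / n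
        ≤ ∑ n ∈ Finset.Ioc ⌊x * 2 ^ N⌋₊ ⌊x * 2 ^ (N + 1)⌋₊, f n / (x * 2 ^ N) := by
          refine Finset.sum_le_sum fun n hn => ?_
          have : x * 2 ^ N < n := (Nat.floor_lt (by positivity)).1 (Finset.mem_Ioc.1 hn).1
          have := hf n
          gcongr
      _ ≤ ∑ n ∈ Finset.Ioc 0 ⌊x * 2 ^ (N + 1)⌋₊, f n / (x * 2 ^ N) := by
          refine Finset.sum_le_sum_of_subset_of_nonneg
            (Finset.Ioc_subset_Ioc_left (Nat.zero_le _)) fun n _ _ => ?_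
          have := hf n
          positivity
      _ ≤ C * Real.log (2 * (x * 2 ^ (N + 1))) ^ d / (x * 2 ^ N) := by
          rw [← Finset.sum_div]
          gcongr
          exact h _ (hy.trans hy2)
      _ ≤ C * ((N + 2) * Real.log (2 * x)) ^ d / (x * 2 ^ N) := by
          have h1 : Real.log (2 * (x * 2 ^ (N + 1))) =
              Real.log (2 * x) + (N + 1) * Real.log 2 := by
            rw [← mul_assoc, Real.log_mul (by positivity) (by positivity), Real.log_pow]
            push_cast; ring
          have h2 : Real.log 2 ≤ Real.log (2 * x) := Real.log_le_log (by norm_num) (by linarith)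
          have h3 : 0 ≤ Real.log (2 * (x * 2 ^ (N + 1))) := Real.log_nonneg (by linarith)
          gcongr
          rw [h1]
          nlinarith [(Nat.cast_nonneg N : (0 : ℝ) ≤ N)]
      _ = _ := by rw [mul_pow]; field_simp

lemma exists_sum_tail_le {f : ℕ → ℝ} (hf : ∀ n, 0 ≤ f n) {C : ℝ} {d : ℕ}
    (h : ∀ x : ℝ, 1 ≤ x → ∑ n ∈ Finset.Ioc 0 ⌊x⌋₊, f n ≤ C * Real.log (2 * x) ^ d) (hC : 0 ≤ C) :
    ∃ C' : ℝ, ∀ x : ℝ, 1 ≤ x → ∀ s : Finset ℕ, (∀ n ∈ s, ⌊x⌋₊ < n) →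
      ∑ n ∈ s, f n / n ≤ C' * Real.log (2 * x) ^ d / x := by
  have hsum : Summable fun k : ℕ => ((k : ℝ) + 2) ^ d / 2 ^ k := by
    have h1 := summable_pow_mul_geometric_of_norm_lt_one (R := ℝ) d (r := 1 / 2) (by norm_num)
    have h2 := ((summable_nat_add_iff 2).2 h1).mul_left 4
    refine h2.congr fun k => ?_
    push_cast
    rw [one_div, inv_pow, pow_add]
    field_simp
    norm_num
  refine ⟨C * ∑' k : ℕ, ((k : ℝ) + 2) ^ d / 2 ^ k, fun x hx s hs => ?_⟩
  have hlog : 0 ≤ Real.log (2 * x) := Real.log_nonneg (by linarith)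
  have hsub : s ⊆ Finset.Ioc ⌊x⌋₊ ⌊x * 2 ^ (s.sup id)⌋₊ := fun n hn => by
    refine Finset.mem_Ioc.2 ⟨hs n hn, Nat.le_floor ?_⟩
    have h1 : n ≤ s.sup id := Finset.le_sup (f := id) hn
    have h2 : (n : ℝ) ≤ 2 ^ (s.sup id) := by
      exact_mod_cast h1.trans (Nat.lt_two_pow_self).le
    exact h2.trans (le_mul_of_one_le_left (by positivity) hx)
  calc ∑ n ∈ s, f n / n ≤ ∑ n ∈ Finset.Ioc ⌊x⌋₊ ⌊x * 2 ^ (s.sup id)⌋₊, f n / n :=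
        Finset.sum_le_sum_of_subset_of_nonneg hsub fun n _ _ => div_nonneg (hf n) (by positivity)
    _ ≤ _ := sum_dyadic_le hf h hC hx _
    _ ≤ C * Real.log (2 * x) ^ d / x * ∑' k : ℕ, ((k : ℝ) + 2) ^ d / 2 ^ k := by
        gcongr
        exact hsum.sum_le_tsum _ fun k _ => by positivity
    _ = _ := by ring

lemma exists_sum_norm_alphaF_div_sq_tail_le {d : ℕ} (a : ℕ → Fin d → ℂ)
    (ha : ∀ p : ℕ, p.Prime → ∀ j : Fin d, ‖a p j‖ ≤ 1) :
    ∃ C : ℝ, ∀ x : ℝ, 1 ≤ x → ∀ s : Finset ℕ, (∀ n ∈ s, ⌊x⌋₊ < n) →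
      ∑ n ∈ s, ‖alphaF a n / (n : ℂ) ^ 2‖ ≤ C * Real.log (2 * x) ^ d / x := by
  obtain ⟨C, hC⟩ := exists_sum_tail_le (f := fun n => ‖alphaF a n‖ / n)
    (fun n => by positivity) (fun x hx => sum_norm_alphaF_div_le a ha hx) (by positivity)
  refine ⟨C, fun x hx s hs => (le_of_eq ?_).trans (hC x hx s hs)⟩
  refine Finset.sum_congr rfl fun n _ => ?_
  rw [norm_div, norm_pow, Complex.norm_natCast, div_div, sq]

lemma summable_norm_alphaF_div_sq {d : ℕ} (a : ℕ → Fin d → ℂ)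
    (ha : ∀ p : ℕ, p.Prime → ∀ j : Fin d, ‖a p j‖ ≤ 1) :
    Summable fun n : ℕ => ‖alphaF a n / (n : ℂ) ^ 2‖ := by
  obtain ⟨C, hC⟩ := exists_sum_norm_alphaF_div_sq_tail_le a ha
  refine (summable_nat_add_iff 2).1 (summable_of_sum_le (c := C * Real.log (2 * 1) ^ d / 1)
    (fun n => norm_nonneg _) fun s => ?_)
  have := hC 1 le_rfl (s.map (addRightEmbedding 2)) (by simp)
  rwa [Finset.sum_map] at this

lemma tsum_alphaF_div_sq {d : ℕ} (a : ℕ → Fin d → ℂ)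
    (ha : ∀ p : ℕ, p.Prime → ∀ j : Fin d, ‖a p j‖ ≤ 1) :
    ∏' p : Nat.Primes, (1 - gammaF a (p : ℕ) / ((p : ℕ) : ℂ) ^ 2) =
      ∑' n : ℕ, alphaF a n / (n : ℂ) ^ 2 := by
  have hA := alphaArith_isMultiplicative a
  have h := EulerProduct.eulerProduct_hasProd (f := fun n : ℕ => alphaF a n / (n : ℂ) ^ 2)
    (by have := hA.map_one; rw [alphaArith_apply] at this; simp [this])
    (fun {m n} hmn => by
      have := hA.map_mul_of_coprime hmn
      simp only [alphaArith_apply] at this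
      rw [this]; push_cast; rw [mul_pow, mul_div_mul_comm])
    (summable_norm_alphaF_div_sq a ha) (by simp)
  rw [← h.tprod_eq]
  refine tprod_congr fun p => ?_
  rw [tsum_eq_sum (s := Finset.range 2)]
  · have := hA.map_one
    rw [alphaArith_apply] at this
    simp [Finset.sum_range_succ, this, alphaF_prime a p.2]
    ring
  · intro k hk
    rw [alphaF_prime_pow a p.2 (not_lt.1 (mt Finset.mem_range.2 hk)), zero_div]

lemma norm_sum_sub_tsum_le {d : ℕ} (a : ℕ → Fin d → ℂ)
    (ha : ∀ p : ℕ, p.Prime → ∀ j : Fin d, ‖a p j‖ ≤ 1) :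
    ∃ C : ℝ, ∀ x : ℝ, 1 ≤ x →
      ‖∑ n ∈ Finset.Ioc 0 ⌊x⌋₊, alphaF a n / (n : ℂ) ^ 2 - ∑' n : ℕ, alphaF a n / (n : ℂ) ^ 2‖ ≤
        C * Real.log (2 * x) ^ d / x := by
  obtain ⟨C, hC⟩ := exists_sum_norm_alphaF_div_sq_tail_le a ha
  refine ⟨C, fun x hx => ?_⟩
  have hs := (summable_norm_alphaF_div_sq a ha).of_norm.hasSum.tendsto_sum_nat
  refine le_of_tendsto (tendsto_const_nhds.sub hs).norm ?_
  filter_upwards [eventually_ge_atTop (⌊x⌋₊ + 1)] with N hN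
  have h1 : ∑ n ∈ Finset.range N, alphaF a n / (n : ℂ) ^ 2 =
      ∑ n ∈ Finset.Ioc 0 (N - 1), alphaF a n / (n : ℂ) ^ 2 := by
    have h0 : Finset.range N = insert 0 (Finset.Ioc 0 (N - 1)) := by
      ext n; simp; omega
    rw [h0, Finset.sum_insert (by simp)]
    simp
  rw [h1, ← Finset.sum_Ioc_consecutive _ (Nat.zero_le ⌊x⌋₊) (by omega : ⌊x⌋₊ ≤ N - 1),
    sub_add_cancel_left, norm_neg]
  exact (norm_sum_le _ _).trans (hC x hx _ fun n hn => (Finset.mem_Ioc.1 hn).1)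

/-- The arithmetic function underlying `phiF`. -/
noncomputable def phiArith {d : ℕ} (a : ℕ → Fin d → ℂ) : ArithmeticFunction ℂ :=
  ⟨phiF a, by simp [phiF]⟩

lemma phiArith_apply {d : ℕ} (a : ℕ → Fin d → ℂ) (n : ℕ) : phiArith a n = phiF a n := rfl

lemma phiArith_isMultiplicative {d : ℕ} (a : ℕ → Fin d → ℂ) :
    (phiArith a).IsMultiplicative := by
  refine ⟨by simp [phiArith_apply, phiF], fun {m n} h => ?_⟩
  simp only [phiArith_apply, phiF]
  rw [h.primeFactors_mul, Finset.prod_union h.disjoint_primeFactors]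
  push_cast; ring

lemma phiArith_eq_mul {d : ℕ} (a : ℕ → Fin d → ℂ) :
    phiArith a =
      alphaArith a * ((ArithmeticFunction.id : ArithmeticFunction ℕ) : ArithmeticFunction ℂ) := by
  refine ((phiArith_isMultiplicative a).eq_iff_eq_on_prime_powers _ _
    ((alphaArith_isMultiplicative a).mul ArithmeticFunction.isMultiplicative_id.natCast)).2
    fun p k hp => ?_
  have h1 : alphaF a 1 = 1 := (alphaArith_isMultiplicative a).map_one
  rcases k with _ | k
  · rw [pow_zero, (phiArith_isMultiplicative a).map_one, ((alphaArith_isMultiplicative a).mul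
      ArithmeticFunction.isMultiplicative_id.natCast).map_one]
  rw [ArithmeticFunction.mul_apply, Nat.sum_divisorsAntidiagonal (fun i j => alphaArith a i *
    ((ArithmeticFunction.id : ArithmeticFunction ℕ) : ArithmeticFunction ℂ) j),
    Nat.divisors_prime_pow hp, Finset.sum_map,
    ← Finset.sum_subset (s₁ := Finset.range 2) (by intro i; simp; omega)]
  · have h2 : p ^ (k + 1) / p = p ^ k := by rw [pow_succ, Nat.mul_div_cancel _ hp.pos]
    simp only [Finset.sum_range_succ, Finset.sum_range_zero, Function.Embedding.coeFn_mk, pow_zero,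
      pow_one, zero_add, h1, Nat.div_one, h2, ArithmeticFunction.natCoe_apply,
      ArithmeticFunction.id_apply, alphaArith_apply, alphaF_prime a hp, phiArith_apply, phiF,
      Nat.primeFactors_prime_pow (Nat.succ_ne_zero k) hp, Finset.prod_singleton, gammaF]
    generalize ∏ j : Fin d, (1 - a p j / (p : ℂ)) = P
    push_cast
    ring
  · intro i _ hi
    simp only [Function.Embedding.coeFn_mk, alphaArith_apply]
    rw [alphaF_prime_pow a hp (not_lt.1 (mt Finset.mem_range.2 hi)), zero_mul]

lemma abs_sum_Ioc_floor_sub_le {u : ℝ} (hu : 0 ≤ u) :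
    |(∑ k ∈ Finset.Ioc 0 ⌊u⌋₊, (k : ℝ)) - u ^ 2 / 2| ≤ u / 2 := by
  have h : ∀ N : ℕ, ∑ k ∈ Finset.Ioc 0 N, (k : ℝ) = N * (N + 1) / 2 := fun N => by
    induction N with
    | zero => simp
    | succ N ih => rw [Finset.sum_Ioc_succ_top (Nat.zero_le _), ih]; push_cast; ring
  rw [h, abs_le]
  have h1 := Nat.floor_le hu
  have h2 := Nat.lt_floor_add_one u
  have h3 : (0 : ℝ) ≤ ⌊u⌋₊ := Nat.cast_nonneg _
  constructor <;> nlinarith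

lemma sum_phiF_eq {d : ℕ} (a : ℕ → Fin d → ℂ) (x : ℝ) :
    ∑ n ∈ Finset.Icc 1 ⌊x⌋₊, phiF a n =
      ∑ m ∈ Finset.Ioc 0 ⌊x⌋₊,
        alphaF a m * ((∑ k ∈ Finset.Ioc 0 ⌊x / m⌋₊, (k : ℝ) : ℝ) : ℂ) := by
  have h := ArithmeticFunction.sum_Ioc_mul_eq_sum_sum (alphaArith a)
    ((ArithmeticFunction.id : ArithmeticFunction ℕ) : ArithmeticFunction ℂ) ⌊x⌋₊
  rw [← phiArith_eq_mul] at h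
  refine h.trans (Finset.sum_congr rfl fun m _ => ?_)
  rw [Nat.floor_div_natCast]
  simp [alphaArith_apply]

/-- Kaczorowski's asymptotic formula: for a polynomial Euler product of degree `d`,
`∑_{n ≤ x} φ(n,F) = C(F) x² + O(x (log 2x)^d)` for `x ≥ 1`, where
`C(F) = (1/2) ∏_p (1 - γ(p)/p²)`. -/
theorem sum_phiF_asymptotic {d : ℕ} (a : ℕ → Fin d → ℂ)
    (ha : ∀ p : ℕ, p.Prime → ∀ j : Fin d, ‖a p j‖ ≤ 1) :
    ∃ c : ℝ, ∀ x : ℝ, 1 ≤ x →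
      ‖(∑ n ∈ Finset.Icc 1 ⌊x⌋₊, phiF a n) -
        ((1/2 : ℂ) * ∏' p : Nat.Primes, (1 - gammaF a (p : ℕ) / ((p : ℕ) : ℂ) ^ 2)) *
          (x : ℂ) ^ 2‖ ≤ c * x * (Real.log (2 * x)) ^ d := by
  obtain ⟨C, hC⟩ := norm_sum_sub_tsum_le a ha
  refine ⟨3 ^ d * 2 ^ 3 ^ d / 2 + C / 2, fun x hx => ?_⟩
  have hx0 : 0 < x := by linarith
  rw [tsum_alphaF_div_sq a ha, sum_phiF_eq]
  have hsplit : (∑ m ∈ Finset.Ioc 0 ⌊x⌋₊,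
        alphaF a m * ((∑ k ∈ Finset.Ioc 0 ⌊x / m⌋₊, (k : ℝ) : ℝ) : ℂ)) -
      1 / 2 * (∑' n : ℕ, alphaF a n / (n : ℂ) ^ 2) * (x : ℂ) ^ 2 =
      (∑ m ∈ Finset.Ioc 0 ⌊x⌋₊, alphaF a m *
        ((∑ k ∈ Finset.Ioc 0 ⌊x / m⌋₊, (k : ℝ) - (x / m) ^ 2 / 2 : ℝ) : ℂ)) +
      (x : ℂ) ^ 2 / 2 * (∑ n ∈ Finset.Ioc 0 ⌊x⌋₊, alphaF a n / (n : ℂ) ^ 2 -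
        ∑' n : ℕ, alphaF a n / (n : ℂ) ^ 2) := by
    rw [mul_sub, Finset.mul_sum, add_sub, ← Finset.sum_add_distrib]
    congr 1
    · refine Finset.sum_congr rfl fun m _ => ?_
      push_cast
      ring
    · ring
  rw [hsplit]
  have h1 : ‖∑ m ∈ Finset.Ioc 0 ⌊x⌋₊, alphaF a m *
      ((∑ k ∈ Finset.Ioc 0 ⌊x / m⌋₊, (k : ℝ) - (x / m) ^ 2 / 2 : ℝ) : ℂ)‖ ≤
      x / 2 * (3 ^ d * 2 ^ 3 ^ d * Real.log (2 * x) ^ d) := by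
    calc _ ≤ ∑ m ∈ Finset.Ioc 0 ⌊x⌋₊, x / 2 * (‖alphaF a m‖ / m) := by
          refine norm_sum_le_of_le _ fun m _ => ?_
          rw [norm_mul, Complex.norm_real, Real.norm_eq_abs]
          calc _ ≤ ‖alphaF a m‖ * (x / m / 2) := by
                gcongr
                exact abs_sum_Ioc_floor_sub_le (by positivity)
            _ = _ := by ring
      _ ≤ _ := by
          rw [← Finset.mul_sum]
          gcongr
          exact sum_norm_alphaF_div_le a ha hx
  have h2 : ‖(x : ℂ) ^ 2 / 2 * (∑ n ∈ Finset.Ioc 0 ⌊x⌋₊, alphaF a n / (n : ℂ) ^ 2 -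
        ∑' n : ℕ, alphaF a n / (n : ℂ) ^ 2)‖ ≤ x ^ 2 / 2 * (C * Real.log (2 * x) ^ d / x) := by
    rw [norm_mul, norm_div, norm_pow, Complex.norm_real, Real.norm_of_nonneg hx0.le,
      Complex.norm_ofNat]
    gcongr
    exact hC x hx
  refine (norm_add_le _ _).trans ((add_le_add h1 h2).trans (le_of_eq ?_))
  field_simp
end

section
/- With the notation of the previous setup (polynomial Euler product F, α(n), C(F), E₂(x,F), f₁(x,F), all with ∑α(n)/n convergent), for every complex number A the function F₁(x) = (f₁(x,F) + A)·x solves the Volterra integral equation of second type F₁(x) - ∫₀ˣ F₁(t)/t dt = E₂(x,F) for all x ≥ 0, and every solution of this equation (satisfying ∫₀ˣ |F₁(t)|/t dt < ∞) is of this form. -/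
open Filter Topology Classical

/-- The saw-tooth function: `s(x) = 0` for integer `x`, `1/2 - {x}` otherwise. -/
noncomputable def saw (x : ℝ) : ℝ := if ∃ k : ℤ, x = (k : ℝ) then 0 else 1/2 - Int.fract x

theorem norm_gammaF_le {d : ℕ} (a : ℕ → Fin d → ℂ)
    (ha : ∀ p : ℕ, p.Prime → ∀ j : Fin d, ‖a p j‖ ≤ 1) {p : ℕ} (hp : p.Prime) :
    ‖gammaF a p‖ ≤ d * Real.exp d := by
  have hp0 : (0 : ℝ) < p := by exact_mod_cast hp.pos
  have hp1 : (1 : ℝ) ≤ p := by exact_mod_cast hp.one_lt.le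
  have hprod := Finset.univ.norm_prod_one_add_sub_one_le (fun j : Fin d => -(a p j / (p : ℂ)))
  simp only [← sub_eq_add_neg, norm_neg, norm_div, Complex.norm_natCast] at hprod
  have hsum : ∑ j : Fin d, ‖a p j‖ / (p : ℝ) ≤ d / p := by
    calc ∑ j : Fin d, ‖a p j‖ / (p : ℝ) ≤ ∑ _j : Fin d, 1 / (p : ℝ) :=
          Finset.sum_le_sum fun j _ => div_le_div_of_nonneg_right (ha p hp j) hp0.le
      _ = d / p := by simp [div_eq_mul_inv]
  set y : ℝ := d / p with hy
  have hy0 : 0 ≤ y := by positivity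
  have hyd : y ≤ d := div_le_self (by positivity) hp1
  have hexp : Real.exp y - 1 ≤ y * Real.exp y := by
    have h := Real.add_one_le_exp (-y)
    have h2 := mul_le_mul_of_nonneg_right h (Real.exp_pos y).le
    rw [← Real.exp_add, neg_add_cancel, Real.exp_zero] at h2
    linarith
  have hexp2 : y * Real.exp y ≤ y * Real.exp d :=
    mul_le_mul_of_nonneg_left (Real.exp_le_exp.2 hyd) hy0
  rw [gammaF, norm_mul, Complex.norm_natCast, norm_sub_rev]
  calc (p : ℝ) * ‖∏ j : Fin d, (1 - a p j / (p : ℂ)) - 1‖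
      ≤ p * (y * Real.exp d) := by
        refine mul_le_mul_of_nonneg_left ?_ hp0.le
        have := Real.exp_le_exp.2 hsum
        linarith
    _ = d * Real.exp d := by rw [hy]; field_simp

theorem summable_norm_gammaF_div_sq {d : ℕ} (a : ℕ → Fin d → ℂ)
    (ha : ∀ p : ℕ, p.Prime → ∀ j : Fin d, ‖a p j‖ ≤ 1) :
    Summable fun p : Nat.Primes => ‖-(gammaF a (p : ℕ) / ((p : ℕ) : ℂ) ^ 2)‖ := by
  have hs : Summable fun p : Nat.Primes => (d * Real.exp d) * (1 / ((p : ℕ) : ℝ) ^ 2) :=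
    ((Real.summable_one_div_nat_pow.2 one_lt_two).comp_injective
      (Nat.Primes.coe_nat_injective)).mul_left _
  refine hs.of_nonneg_of_le (fun _ => norm_nonneg _) fun p => ?_
  rw [norm_neg, norm_div, norm_pow, Complex.norm_natCast, div_eq_mul_one_div]
  exact mul_le_mul_of_nonneg_right (norm_gammaF_le a ha p.2) (by positivity)

theorem prod_image_primes {M : Type*} [CommMonoid M] (s : Finset Nat.Primes) (f : ℕ → M) :
    ∏ p ∈ s.image (fun p : Nat.Primes => (p : ℕ)), f p = ∏ p ∈ s, f (p : ℕ) :=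
  Finset.prod_image fun _ _ _ _ h => Nat.Primes.coe_nat_injective h

theorem primeFactors_prod_primes (s : Finset Nat.Primes) :
    (∏ p ∈ s, (p : ℕ)).primeFactors = s.image (fun p : Nat.Primes => (p : ℕ)) := by
  rw [← Nat.primeFactors_prod (s := s.image fun p : Nat.Primes => (p : ℕ)), prod_image_primes]
  · intro p hp
    obtain ⟨q, -, rfl⟩ := Finset.mem_image.1 hp
    exact q.2

theorem alphaF_prod_primes {d : ℕ} (a : ℕ → Fin d → ℂ) (s : Finset Nat.Primes) :
    alphaF a (∏ p ∈ s, (p : ℕ)) = ∏ p ∈ s, -gammaF a (p : ℕ) := by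
  have hm : ArithmeticFunction.moebius (∏ p ∈ s, (p : ℕ)) = ∏ p ∈ s, (-1 : ℤ) := by
    have h := ArithmeticFunction.isMultiplicative_moebius.map_prod_of_prime
      (s.image (fun p : Nat.Primes => (p : ℕ))) (by
        intro p hp
        obtain ⟨q, -, rfl⟩ := Finset.mem_image.1 hp
        exact q.2)
    rw [prod_image_primes, prod_image_primes] at h
    refine h.trans (Finset.prod_congr rfl fun p _ => ?_)
    exact ArithmeticFunction.moebius_apply_prime p.2
  rw [alphaF, primeFactors_prod_primes, prod_image_primes, hm]
  push_cast
  rw [← Finset.prod_mul_distrib]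
  simp

theorem hasSum_alphaF_div_sq {d : ℕ} (a : ℕ → Fin d → ℂ)
    (ha : ∀ p : ℕ, p.Prime → ∀ j : Fin d, ‖a p j‖ ≤ 1) :
    HasSum (fun n : ℕ => alphaF a n / (n : ℂ) ^ 2)
      (∏' p : Nat.Primes, (1 - gammaF a (p : ℕ) / ((p : ℕ) : ℂ) ^ 2)) := by
  have hs := summable_finsetProd_of_summable_norm (summable_norm_gammaF_div_sq a ha)
  have ht := tprod_one_add hs
  simp only [← sub_eq_add_neg] at ht
  rw [ht]
  have hinj : Function.Injective fun s : Finset Nat.Primes => ∏ p ∈ s, (p : ℕ) := by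
    intro s t hst
    have h := congrArg Nat.primeFactors hst
    simp only [primeFactors_prod_primes] at h
    exact Finset.image_injective Nat.Primes.coe_nat_injective h
  rw [← hinj.hasSum_iff]
  · convert! hs.hasSum using 2 with s
    simp only [Function.comp_apply]
    rw [alphaF_prod_primes]
    push_cast
    rw [← Finset.prod_pow, ← Finset.prod_div_distrib]
    simp only [neg_div]
  · intro n hn
    have hsq : ¬ Squarefree n := by
      intro hsq
      refine hn ⟨n.primeFactors.subtype Nat.Prime, ?_⟩
      have h := Finset.prod_subtype_of_mem (s := n.primeFactors) (p := Nat.Prime) (fun x => x)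
        (fun x hx => Nat.prime_of_mem_primeFactors hx)
      exact h.trans (Nat.prod_primeFactors_of_squarefree hsq)
    simp [alphaF, ArithmeticFunction.moebius_eq_zero_of_not_squarefree hsq]

theorem tendsto_sum_Icc_one_of_hasSum {f : ℕ → ℂ} {l : ℂ} (hf : HasSum f l) (h0 : f 0 = 0) :
    Tendsto (fun N : ℕ => ∑ n ∈ Finset.Icc 1 N, f n) atTop (𝓝 l) := by
  refine ((tendsto_add_atTop_iff_nat 1).2 hf.tendsto_sum_nat).congr fun N => ?_
  rw [Finset.sum_range_eq_add_Ico _ (Nat.succ_pos N), h0, zero_add]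
  rfl

/-- Rearranging `∑_{n ≤ X} n ∑_{m ∣ n} c(m)/m` according to the value of `m`. -/
theorem sum_mul_sum_divisors_eq (c : ℕ → ℂ) (N X : ℕ) (hX : X ≤ N) :
    ∑ n ∈ Finset.Icc 1 X, (n : ℂ) * ∑ m ∈ n.divisors, c m / (m : ℂ) =
      ∑ m ∈ Finset.Icc 1 N, c m * (((X / m : ℕ) : ℂ) * (((X / m : ℕ) : ℂ) + 1) / 2) := by
  induction X with
  | zero => simp
  | succ X ih =>
    rw [Finset.sum_Icc_succ_top (by omega), ih (by omega)]
    have hdiv : (X + 1).divisors = (Finset.Icc 1 N).filter (· ∣ X + 1) := by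
      ext m
      simp only [Nat.mem_divisors, Finset.mem_filter, Finset.mem_Icc]
      constructor
      · rintro ⟨h, -⟩
        exact ⟨⟨Nat.pos_of_dvd_of_pos h (by omega), (Nat.le_of_dvd (by omega) h).trans hX⟩, h⟩
      · rintro ⟨-, h⟩
        exact ⟨h, by omega⟩
    rw [hdiv, Finset.sum_filter, Finset.mul_sum, ← Finset.sum_add_distrib]
    refine Finset.sum_congr rfl fun m hm => ?_
    have hm0 : (m : ℂ) ≠ 0 := by
      have := (Finset.mem_Icc.1 hm).1
      exact_mod_cast (by omega : m ≠ 0)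
    by_cases h : m ∣ X + 1
    · have hq : ((X + 1 : ℕ) : ℂ) = m * (((X + 1) / m : ℕ) : ℂ) := by
        exact_mod_cast (Nat.mul_div_cancel' h).symm
      rw [if_pos h, hq, Nat.succ_div, if_pos h]
      push_cast
      field_simp
      ring
    · rw [if_neg h, Nat.succ_div, if_neg h]
      simp

theorem measurable_saw : Measurable saw := by
  have h : MeasurableSet {x : ℝ | ∃ k : ℤ, x = (k : ℝ)} := by
    have : {x : ℝ | ∃ k : ℤ, x = (k : ℝ)} = Set.range ((↑) : ℤ → ℝ) := by
      ext x
      simp [eq_comm]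
    rw [this]
    exact (Set.countable_range _).measurableSet
  exact Measurable.ite h measurable_const (measurable_const.sub measurable_fract)

theorem abs_saw_le (x : ℝ) : |saw x| ≤ 1 / 2 := by
  unfold saw
  split_ifs
  · norm_num
  · rw [abs_le]
    constructor <;> linarith [Int.fract_nonneg x, Int.fract_lt_one x]

theorem saw_eq_of_mem_Ioo {x : ℝ} (h0 : 0 < x) (h1 : x < 1) : saw x = 1 / 2 - x := by
  have hf : Int.fract x = x := Int.fract_eq_self.2 ⟨h0.le, h1⟩
  unfold saw
  rw [if_neg, hf]
  rintro ⟨k, rfl⟩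
  have h0' : (0 : ℤ) < k := by exact_mod_cast h0
  have h1' : k < (1 : ℤ) := by exact_mod_cast h1
  omega

/-- The primitive of the saw-tooth function vanishing at the integers. -/
noncomputable def sawPrimitive (x : ℝ) : ℝ := (Int.fract x - Int.fract x ^ 2) / 2

theorem continuous_sawPrimitive : Continuous sawPrimitive :=
  ContinuousOn.comp_fract'' (f := fun y : ℝ => (y - y ^ 2) / 2)
    (by fun_prop) (by norm_num)

theorem hasDerivAt_sawPrimitive {x : ℝ} (hx : ¬ ∃ k : ℤ, x = (k : ℝ)) :
    HasDerivAt sawPrimitive (saw x) x := by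
  have hlt : (⌊x⌋ : ℝ) < x := lt_of_le_of_ne (Int.floor_le x) fun h => hx ⟨_, h.symm⟩
  have hev : sawPrimitive =ᶠ[𝓝 x] fun y => ((y - ⌊x⌋) - (y - ⌊x⌋) ^ 2) / 2 := by
    filter_upwards [Ioo_mem_nhds hlt (Int.lt_floor_add_one x)] with y hy
    have : ⌊y⌋ = ⌊x⌋ := Int.floor_eq_iff.2 ⟨hy.1.le, hy.2⟩
    simp only [sawPrimitive, Int.fract, this]
  refine HasDerivAt.congr_of_eventuallyEq ?_ hev
  have h1 : HasDerivAt (fun y : ℝ => y - ⌊x⌋) 1 x := (hasDerivAt_id x).sub_const _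
  convert! (h1.sub (h1.pow 2)).div_const 2 using 1
  rw [saw, if_neg hx, Int.fract]
  norm_num
  ring

theorem integral_saw (x : ℝ) : ∫ t in (0 : ℝ)..x, saw t = sawPrimitive x := by
  have h := MeasureTheory.integral_eq_of_hasDerivAt_off_countable sawPrimitive saw
    (a := 0) (b := x) (Set.countable_range ((↑) : ℤ → ℝ)) continuous_sawPrimitive.continuousOn
    (fun y hy => hasDerivAt_sawPrimitive fun ⟨k, hk⟩ => hy.2 ⟨k, hk.symm⟩) ?_
  · rw [h]
    simp [sawPrimitive]
  · refine (intervalIntegrable_const (c := (1 / 2 : ℝ))).mono_fun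
      measurable_saw.aestronglyMeasurable (MeasureTheory.ae_of_all _ fun y => ?_)
    change |saw y| ≤ |(1 / 2 : ℝ)|
    rw [abs_of_nonneg (by norm_num : (0 : ℝ) ≤ 1 / 2)]
    exact abs_saw_le y

theorem integral_saw_div {x : ℝ} (hx : 0 ≤ x) {m : ℕ} (hm : m ≠ 0) :
    ∫ t in Set.Ioc 0 x, saw (t / m) = m * sawPrimitive (x / m) := by
  have hm' : (m : ℝ) ≠ 0 := by exact_mod_cast hm
  rw [← intervalIntegral.integral_of_le hx, intervalIntegral.integral_comp_div _ hm', zero_div,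
    integral_saw, smul_eq_mul]

/-- Averaging `k ↦ k(k+1)/2` at `⌊u⌋` over the two one-sided limits, in terms of the
saw-tooth function and its primitive. -/
theorem sq_div_two_add_mul_saw_sub_sawPrimitive (u : ℝ) :
    u ^ 2 / 2 + u * saw u - sawPrimitive u =
      (⌊u⌋ : ℝ) * (⌊u⌋ + 1) / 2 - if ∃ k : ℤ, u = (k : ℝ) then u / 2 else 0 := by
  unfold saw sawPrimitive
  split_ifs with h
  · obtain ⟨k, rfl⟩ := h
    simp
    ring
  · rw [Int.fract]
    ring

theorem exists_int_natCast_div_eq_iff {N m : ℕ} (hm : m ≠ 0) :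
    (∃ k : ℤ, (N : ℝ) / m = (k : ℝ)) ↔ m ∣ N := by
  have hm' : (m : ℝ) ≠ 0 := by exact_mod_cast hm
  constructor
  · rintro ⟨k, hk⟩
    rw [div_eq_iff hm'] at hk
    have : (N : ℤ) = k * m := by exact_mod_cast hk
    exact_mod_cast Dvd.intro_left k this.symm
  · rintro ⟨k, rfl⟩
    refine ⟨k, ?_⟩
    push_cast
    field_simp

theorem eq_natCast_of_div_eq_intCast {x : ℝ} (hx : 0 < x) {m : ℕ} (hm : m ≠ 0) {k : ℤ}
    (h : x / m = k) : ∃ N : ℕ, 0 < N ∧ x = N := by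
  have hm' : (m : ℝ) ≠ 0 := by exact_mod_cast hm
  rw [div_eq_iff hm'] at h
  have hz : (0 : ℤ) < k * m := by
    have : (0 : ℝ) < ((k * m : ℤ) : ℝ) := by push_cast; linarith
    exact_mod_cast this
  refine ⟨(k * m).toNat, by omega, ?_⟩
  have : (((k * m).toNat : ℤ) : ℝ) = ((k * m : ℤ) : ℝ) := by rw [Int.toNat_of_nonneg hz.le]
  rw [h]
  push_cast at this
  exact this.symm

theorem floor_div_natCast_eq {x : ℝ} (hx : 0 ≤ x) (m : ℕ) :
    ⌊x / m⌋ = ((⌊x⌋₊ / m : ℕ) : ℤ) := by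
  rw [← Nat.floor_div_natCast, Int.natCast_floor_eq_floor (by positivity)]

/-- The `N`-th partial sum of the series `∑ c(n)/n * s(t/n)`. -/
noncomputable def sawPartialSum (c : ℕ → ℂ) (N : ℕ) (t : ℝ) : ℂ :=
  ∑ n ∈ Finset.Icc 1 N, (c n / (n : ℂ)) * ((saw (t / n) : ℝ) : ℂ)

theorem measurable_sawPartialSum (c : ℕ → ℂ) (N : ℕ) : Measurable (sawPartialSum c N) :=
  Finset.measurable_fun_sum _ fun _ _ => measurable_const.mul
    (Complex.measurable_ofReal.comp (measurable_saw.comp (measurable_id.div_const _)))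

theorem exists_norm_sawPartialSum_le {c : ℕ → ℂ}
    (hconv : ∃ l : ℂ, Tendsto (fun N : ℕ => ∑ n ∈ Finset.Icc 1 N, c n / (n : ℂ)) atTop (𝓝 l))
    (hsum : Summable fun n : ℕ => c n / (n : ℂ) ^ 2) (x : ℝ) :
    ∃ K : ℝ, ∀ N : ℕ, ∀ t ∈ Set.Ioc 0 x, ‖sawPartialSum c N t‖ ≤ K := by
  obtain ⟨l, hl⟩ := hconv
  obtain ⟨P, hP⟩ := (Metric.isBounded_range_of_tendsto _ hl).exists_norm_le
  set M : ℕ := ⌊x⌋₊ + 1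
  have hxM : x < M := by exact_mod_cast Nat.lt_floor_add_one x
  set Q : ℝ := ∑' n : ℕ, ‖c n / (n : ℂ) ^ 2‖
  refine ⟨P * (1 / 2) + Q * x + ∑ n ∈ Finset.Icc 1 M, ‖c n / (n : ℂ)‖ * (1 + x), ?_⟩
  rintro N t ⟨ht0, htx⟩
  have hx0 : 0 < x := ht0.trans_le htx
  set e : ℕ → ℝ := fun n => saw (t / n) - (1 / 2 - t / n) with he
  have he0 : ∀ n ∈ Finset.Icc 1 N, n ∉ Finset.Icc 1 M → e n = 0 := by
    intro n hn hnM
    have hn1 := (Finset.mem_Icc.1 hn).1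
    have hn2 : M < n := by
      by_contra h
      exact hnM (Finset.mem_Icc.2 ⟨hn1, by omega⟩)
    have hn2' : (M : ℝ) < n := by exact_mod_cast hn2
    have hn0 : (0 : ℝ) < n := by exact_mod_cast hn1
    rw [he]
    simp only
    rw [saw_eq_of_mem_Ioo (by positivity) ((div_lt_one hn0).2 (by linarith)), sub_self]
  have heb : ∀ n : ℕ, 1 ≤ n → ‖((e n : ℝ) : ℂ)‖ ≤ 1 + x := by
    intro n hn
    have hn' : (1 : ℝ) ≤ n := by exact_mod_cast hn
    have h1 : t / n ≤ x := (div_le_self ht0.le hn').trans htx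
    have h2 : 0 ≤ t / n := by positivity
    have h3 := abs_le.1 (abs_saw_le (t / n))
    rw [Complex.norm_real, Real.norm_eq_abs, abs_le]
    simp only [he]
    constructor <;> linarith
  have hsplit : sawPartialSum c N t =
      (∑ n ∈ Finset.Icc 1 N, c n / (n : ℂ)) * (1 / 2) -
        (∑ n ∈ Finset.Icc 1 N, c n / (n : ℂ) ^ 2) * t +
        ∑ n ∈ Finset.Icc 1 N, c n / (n : ℂ) * ((e n : ℝ) : ℂ) := by
    rw [sawPartialSum, Finset.sum_mul, Finset.sum_mul, ← Finset.sum_sub_distrib,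
      ← Finset.sum_add_distrib]
    refine Finset.sum_congr rfl fun n _ => ?_
    simp only [he]
    push_cast
    ring
  rw [hsplit]
  refine (norm_add_le _ _).trans (add_le_add ((norm_sub_le _ _).trans (add_le_add ?_ ?_)) ?_)
  · rw [norm_mul]
    have h := hP _ (Set.mem_range_self N)
    norm_num
    linarith
  · rw [norm_mul, Complex.norm_real, Real.norm_eq_abs, abs_of_pos ht0]
    refine mul_le_mul ((norm_sum_le _ _).trans ?_) htx ht0.le (tsum_nonneg fun _ => norm_nonneg _)
    exact hsum.norm.sum_le_tsum _ fun _ _ => norm_nonneg _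
  · refine (norm_sum_le _ _).trans ?_
    calc ∑ n ∈ Finset.Icc 1 N, ‖c n / (n : ℂ) * ((e n : ℝ) : ℂ)‖
        ≤ ∑ n ∈ Finset.Icc 1 N ∩ Finset.Icc 1 M, ‖c n / (n : ℂ) * ((e n : ℝ) : ℂ)‖ := by
          refine (Finset.sum_subset Finset.inter_subset_left fun n hn hn' => ?_).ge
          rw [he0 n hn fun h => hn' (Finset.mem_inter.2 ⟨hn, h⟩)]
          simp
      _ ≤ ∑ n ∈ Finset.Icc 1 M, ‖c n / (n : ℂ) * ((e n : ℝ) : ℂ)‖ :=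
          Finset.sum_le_sum_of_subset_of_nonneg Finset.inter_subset_right
            fun _ _ _ => norm_nonneg _
      _ ≤ _ := by
          refine Finset.sum_le_sum fun n hn => ?_
          rw [norm_mul]
          exact mul_le_mul_of_nonneg_left (heb n (Finset.mem_Icc.1 hn).1) (norm_nonneg _)

theorem integral_sawPartialSum (c : ℕ → ℂ) (N : ℕ) {x : ℝ} (hx : 0 ≤ x) :
    ∫ t in Set.Ioc 0 x, sawPartialSum c N t =
      ∑ n ∈ Finset.Icc 1 N, c n * ((sawPrimitive (x / n) : ℝ) : ℂ) := by
  unfold sawPartialSum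
  rw [MeasureTheory.integral_finsetSum]
  · refine Finset.sum_congr rfl fun n hn => ?_
    have hn0 : n ≠ 0 := by
      have := (Finset.mem_Icc.1 hn).1
      omega
    have hn0' : (n : ℂ) ≠ 0 := by exact_mod_cast hn0
    rw [MeasureTheory.integral_const_mul, integral_complex_ofReal, integral_saw_div hx hn0]
    push_cast
    field_simp
  · intro n _
    refine MeasureTheory.Integrable.const_mul (MeasureTheory.Integrable.ofReal ?_) _
    refine MeasureTheory.Integrable.of_bound
      (measurable_saw.comp (measurable_id.div_const _)).aestronglyMeasurable (1 / 2)
      (MeasureTheory.ae_of_all _ fun y => abs_saw_le _)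

theorem integrableOn_sawSeries {c : ℕ → ℂ}
    (hconv : ∃ l : ℂ, Tendsto (fun N : ℕ => ∑ n ∈ Finset.Icc 1 N, c n / (n : ℂ)) atTop (𝓝 l))
    (hsum : Summable fun n : ℕ => c n / (n : ℂ) ^ 2) {f : ℝ → ℂ}
    (hf : ∀ x : ℝ, Tendsto (fun N : ℕ => sawPartialSum c N x) atTop (𝓝 (f x))) (x : ℝ) :
    MeasureTheory.IntegrableOn f (Set.Ioc 0 x) := by
  obtain ⟨K, hK⟩ := exists_norm_sawPartialSum_le hconv hsum x
  have hmeas : Measurable f :=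
    measurable_of_tendsto_metrizable (measurable_sawPartialSum c) (tendsto_pi_nhds.2 hf)
  refine MeasureTheory.Integrable.of_bound hmeas.aestronglyMeasurable K ?_
  filter_upwards [MeasureTheory.ae_restrict_mem measurableSet_Ioc] with t ht
  exact le_of_tendsto (hf t).norm (Eventually.of_forall fun N => hK N t ht)

theorem tendsto_integral_sawPartialSum {c : ℕ → ℂ}
    (hconv : ∃ l : ℂ, Tendsto (fun N : ℕ => ∑ n ∈ Finset.Icc 1 N, c n / (n : ℂ)) atTop (𝓝 l))
    (hsum : Summable fun n : ℕ => c n / (n : ℂ) ^ 2) {f : ℝ → ℂ}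
    (hf : ∀ x : ℝ, Tendsto (fun N : ℕ => sawPartialSum c N x) atTop (𝓝 (f x))) (x : ℝ) :
    Tendsto (fun N : ℕ => ∫ t in Set.Ioc 0 x, sawPartialSum c N t) atTop
      (𝓝 (∫ t in Set.Ioc 0 x, f t)) := by
  obtain ⟨K, hK⟩ := exists_norm_sawPartialSum_le hconv hsum x
  refine MeasureTheory.tendsto_integral_of_dominated_convergence (fun _ => K)
    (fun N => (measurable_sawPartialSum c N).aestronglyMeasurable)
    (MeasureTheory.integrable_const K) (fun N => ?_) (MeasureTheory.ae_of_all _ hf)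
  filter_upwards [MeasureTheory.ae_restrict_mem measurableSet_Ioc] with t ht
  exact hK N t ht

/-- The average of the one-sided limits at `x` of the summatory function of
`n ↦ n ∑_{m ∣ n} c(m)/m`, expressed through the saw-tooth function. -/
theorem sum_mul_average_eq (c : ℕ → ℂ) (N : ℕ) {x : ℝ} (hx : 0 ≤ x) :
    ∑ m ∈ Finset.Icc 1 N, c m * ((((⌊x⌋₊ / m : ℕ) : ℂ) * (((⌊x⌋₊ / m : ℕ) : ℂ) + 1) / 2) -
        if ∃ k : ℤ, x / m = (k : ℝ) then (x : ℂ) / m / 2 else 0) =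
      (∑ m ∈ Finset.Icc 1 N, c m / (m : ℂ) ^ 2) * (x ^ 2 / 2) + sawPartialSum c N x * x -
        ∫ t in Set.Ioc 0 x, sawPartialSum c N t := by
  rw [integral_sawPartialSum c N hx, sawPartialSum, Finset.sum_mul, Finset.sum_mul,
    ← Finset.sum_add_distrib, ← Finset.sum_sub_distrib]
  refine Finset.sum_congr rfl fun m _ => ?_
  have h := sq_div_two_add_mul_saw_sub_sawPrimitive (x / m)
  rw [floor_div_natCast_eq hx, Int.cast_natCast] at h
  have h' := congrArg (fun r : ℝ => (r : ℂ)) h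
  have hite : (((if ∃ k : ℤ, x / m = (k : ℝ) then x / m / 2 else 0 : ℝ)) : ℂ) =
      if ∃ k : ℤ, x / m = (k : ℝ) then (x : ℂ) / m / 2 else 0 := by
    split_ifs <;> simp
  rw [Complex.ofReal_sub _ (ite _ _ _), hite] at h'
  push_cast at h'
  rw [← h']
  ring

theorem average_summatory_eq {c : ℕ → ℂ} {C : ℂ} {E E₂ : ℝ → ℂ}
    (hE : ∀ x : ℝ, E x =
      ∑ n ∈ Finset.Icc 1 ⌊x⌋₊, (n : ℂ) * ∑ m ∈ n.divisors, c m / (m : ℂ) - C * (x : ℂ) ^ 2)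
    (hE₂ : ∀ x : ℝ, (¬ ∃ N : ℕ, 0 < N ∧ x = (N : ℝ)) → E₂ x = E x)
    (hE₂int : ∀ N : ℕ, 0 < N → ∃ Lp Lm : ℂ,
      Tendsto E (nhdsWithin (N : ℝ) (Set.Ioi (N : ℝ))) (𝓝 Lp) ∧
      Tendsto E (nhdsWithin (N : ℝ) (Set.Iio (N : ℝ))) (𝓝 Lm) ∧
      E₂ (N : ℝ) = (Lm + Lp) / 2) {x : ℝ} (hx : 0 ≤ x) {N : ℕ} (hN : ⌊x⌋₊ ≤ N) :
    ∑ m ∈ Finset.Icc 1 N, c m * ((((⌊x⌋₊ / m : ℕ) : ℂ) * (((⌊x⌋₊ / m : ℕ) : ℂ) + 1) / 2) -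
        if ∃ k : ℤ, x / m = (k : ℝ) then (x : ℂ) / m / 2 else 0) = E₂ x + C * x ^ 2 := by
  simp only [mul_sub, Finset.sum_sub_distrib]
  rw [← sum_mul_sum_divisors_eq c N _ hN]
  by_cases hint : ∃ k : ℕ, 0 < k ∧ x = (k : ℝ)
  · obtain ⟨k, hk, rfl⟩ := hint
    rw [Nat.floor_natCast] at hN ⊢
    obtain ⟨Lp, Lm, hp, hm, h2⟩ := hE₂int k hk
    set φ : ℕ → ℂ := fun n => (n : ℂ) * ∑ m ∈ n.divisors, c m / (m : ℂ) with hφ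
    have hlim : ∀ (s : Set ℝ) (S : ℂ), Tendsto (fun y : ℝ => S - C * (y : ℂ) ^ 2)
        (nhdsWithin (k : ℝ) s) (𝓝 (S - C * ((k : ℝ) : ℂ) ^ 2)) := fun s S =>
      (Continuous.tendsto (by fun_prop) _).mono_left nhdsWithin_le_nhds
    have hLp : Lp = ∑ n ∈ Finset.Icc 1 k, φ n - C * ((k : ℝ) : ℂ) ^ 2 := by
      refine tendsto_nhds_unique hp ((hlim _ _).congr' ?_)
      filter_upwards [Ioo_mem_nhdsGT (show (k : ℝ) < k + 1 by linarith)] with y hy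
      have hf : ⌊y⌋₊ = k := (Nat.floor_eq_iff ((Nat.cast_nonneg k).trans hy.1.le)).2 ⟨hy.1.le, hy.2⟩
      rw [hE, hf]
    have hLm : Lm = ∑ n ∈ Finset.Icc 1 (k - 1), φ n - C * ((k : ℝ) : ℂ) ^ 2 := by
      refine tendsto_nhds_unique hm ((hlim _ _).congr' ?_)
      filter_upwards [Ioo_mem_nhdsLT (show ((k - 1 : ℕ) : ℝ) < k by exact_mod_cast by omega)]
        with y hy
      have hk' : (((k - 1 : ℕ) : ℝ)) + 1 = k := by exact_mod_cast Nat.sub_add_cancel hk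
      have hf : ⌊y⌋₊ = k - 1 :=
        (Nat.floor_eq_iff ((Nat.cast_nonneg _).trans hy.1.le)).2 ⟨hy.1.le, by linarith [hy.2]⟩
      rw [hE, hf]
    have hsucc : ∑ n ∈ Finset.Icc 1 k, φ n = ∑ n ∈ Finset.Icc 1 (k - 1), φ n + φ k := by
      obtain ⟨j, rfl⟩ := Nat.exists_eq_add_of_lt hk
      simp only [zero_add, Nat.add_sub_cancel]
      exact Finset.sum_Icc_succ_top (by omega) _
    have hhalf : ∑ m ∈ Finset.Icc 1 N, (c m * if ∃ j : ℤ, (k : ℝ) / m = (j : ℝ)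
        then ((k : ℝ) : ℂ) / m / 2 else 0) = φ k / 2 := by
      have hdiv : k.divisors = (Finset.Icc 1 N).filter (· ∣ k) := by
        ext m
        simp only [Nat.mem_divisors, Finset.mem_filter, Finset.mem_Icc]
        constructor
        · rintro ⟨h, -⟩
          exact ⟨⟨Nat.pos_of_dvd_of_pos h hk, (Nat.le_of_dvd hk h).trans hN⟩, h⟩
        · rintro ⟨-, h⟩
          exact ⟨h, by omega⟩
      simp only [hφ]
      rw [hdiv, Finset.sum_filter, Finset.mul_sum, Finset.sum_div]
      refine Finset.sum_congr rfl fun m hm => ?_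
      have hm0 : m ≠ 0 := by
        have := (Finset.mem_Icc.1 hm).1
        omega
      simp only [exists_int_natCast_div_eq_iff hm0]
      split_ifs
      · push_cast
        ring
      · simp
    rw [hhalf, h2, hLp, hLm, hsucc]
    push_cast
    ring
  · have hzero : ∑ m ∈ Finset.Icc 1 N, (c m * if ∃ j : ℤ, x / m = (j : ℝ)
        then (x : ℂ) / m / 2 else 0) = 0 := by
      refine Finset.sum_eq_zero fun m hm => ?_
      rcases hx.eq_or_lt with rfl | hx'
      · simp
      · have hm0 : m ≠ 0 := by
          have := (Finset.mem_Icc.1 hm).1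
          omega
        rw [if_neg, mul_zero]
        rintro ⟨j, hj⟩
        exact hint (eq_natCast_of_div_eq_intCast hx' hm0 hj)
    rw [hzero, hE₂ x hint, hE]
    ring

/-- A function on `[0, ∞)` equal to the integral of `D(t)/t` over `(0, x]` is linear. -/
theorem exists_eq_const_mul_of_eq_integral_div {D : ℝ → ℂ}
    (hint : ∀ x ≥ (0 : ℝ), MeasureTheory.IntegrableOn (fun t : ℝ => D t / (t : ℂ)) (Set.Ioc 0 x))
    (hD : ∀ x ≥ (0 : ℝ), D x = ∫ t in Set.Ioc (0 : ℝ) x, D t / (t : ℂ)) :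
    ∃ A : ℂ, ∀ x ≥ (0 : ℝ), D x = A * (x : ℂ) := by
  set g : ℝ → ℂ := fun t => D t / (t : ℂ) with hg
  have hint' : ∀ x ≥ (0 : ℝ), IntervalIntegrable g MeasureTheory.volume 0 x := fun x hx =>
    (intervalIntegrable_iff_integrableOn_Ioc_of_le hx).2 (hint x hx)
  have hD' : ∀ x ≥ (0 : ℝ), D x = ∫ t in (0 : ℝ)..x, g t := fun x hx => by
    rw [hD x hx, intervalIntegral.integral_of_le hx]
  have hcont : ∀ x > (0 : ℝ), ContinuousAt D x := by
    intro x hx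
    have h := intervalIntegral.continuousOn_primitive_interval' (hint' (x + 1) (by linarith))
      (Set.left_mem_uIcc)
    have h2 := h.continuousAt (x := x) (by
      rw [Set.uIcc_of_le (by linarith)]
      exact Icc_mem_nhds hx (by linarith))
    refine h2.congr ?_
    filter_upwards [Ioi_mem_nhds hx] with y hy
    exact (hD' y (le_of_lt hy)).symm
  have hgcont : ContinuousOn g (Set.Ioi 0) := fun x hx =>
    ((hcont x hx).div Complex.continuous_ofReal.continuousAt
      (by exact_mod_cast (ne_of_gt hx))).continuousWithinAt
  have hderiv : ∀ x > (0 : ℝ), HasDerivAt D (g x) x := by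
    intro x hx
    have h := intervalIntegral.integral_hasDerivAt_right (hint' x hx.le)
      (hgcont.stronglyMeasurableAtFilter isOpen_Ioi x hx)
      (hgcont.continuousAt (Ioi_mem_nhds hx))
    refine h.congr_of_eventuallyEq ?_
    filter_upwards [Ioi_mem_nhds hx] with y hy
    exact hD' y (le_of_lt hy)
  have hgderiv : ∀ x > (0 : ℝ), HasDerivAt g 0 x := by
    intro x hx
    have hx' : (x : ℂ) ≠ 0 := by exact_mod_cast hx.ne'
    have h := (hderiv x hx).div (Complex.ofRealCLM.hasDerivAt (x := x)) hx'
    convert! h using 1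
    simp [hg, hx']
  refine ⟨g 1, fun x hx => ?_⟩
  rcases hx.eq_or_lt with rfl | hx'
  · rw [hD 0 le_rfl]
    simp
  · have h := isOpen_Ioi.is_const_of_deriv_eq_zero isPreconnected_Ioi
      (fun y hy => (hgderiv y hy).differentiableAt.differentiableWithinAt)
      (fun y hy => (hgderiv y hy).deriv) (Set.mem_Ioi.2 one_pos) (Set.mem_Ioi.2 hx')
    rw [h, hg]
    have hx0 : (x : ℂ) ≠ 0 := by exact_mod_cast hx'.ne'
    field_simp

/-- The solutions of the Volterra integral equation
`F₁(x) - ∫₀ˣ F₁(t)/t dt = E₂(x,F)` (for `x ≥ 0`, with `∫₀ˣ |F₁(t)|/t dt < ∞`)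
are exactly the functions `F₁(x) = (f₁(x,F) + A)x`, `A ∈ ℂ`. -/
theorem volterra_solutions {d : ℕ} (a : ℕ → Fin d → ℂ)
    (ha : ∀ p : ℕ, p.Prime → ∀ j : Fin d, ‖a p j‖ ≤ 1)
    (hconv : ∃ l : ℂ, Tendsto (fun N : ℕ => ∑ n ∈ Finset.Icc 1 N, alphaF a n / (n : ℂ))
      atTop (𝓝 l))
    (C : ℂ)
    (hC : C = (1/2 : ℂ) * ∏' p : Nat.Primes, (1 - gammaF a (p : ℕ) / ((p : ℕ) : ℂ) ^ 2))
    (E : ℝ → ℂ)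
    (hE : ∀ x : ℝ, E x =
      ∑ n ∈ Finset.Icc 1 ⌊x⌋₊, (n : ℂ) * ∑ m ∈ n.divisors, alphaF a m / (m : ℂ) -
        C * (x : ℂ) ^ 2)
    (E₂ : ℝ → ℂ)
    (hE₂ : ∀ x : ℝ, (¬ ∃ N : ℕ, 0 < N ∧ x = (N : ℝ)) → E₂ x = E x)
    (hE₂int : ∀ N : ℕ, 0 < N → ∃ Lp Lm : ℂ,
      Tendsto E (nhdsWithin (N : ℝ) (Set.Ioi (N : ℝ))) (𝓝 Lp) ∧
      Tendsto E (nhdsWithin (N : ℝ) (Set.Iio (N : ℝ))) (𝓝 Lm) ∧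
      E₂ (N : ℝ) = (Lm + Lp) / 2)
    (f₁ : ℝ → ℂ)
    (hf₁ : ∀ x : ℝ, Tendsto
      (fun N : ℕ => ∑ n ∈ Finset.Icc 1 N, (alphaF a n / (n : ℂ)) * ((saw (x / n) : ℝ) : ℂ))
      atTop (𝓝 (f₁ x))) :
    (∀ A : ℂ,
      (∀ x ≥ (0:ℝ), MeasureTheory.IntegrableOn
        (fun t : ℝ => (f₁ t + A) * (t : ℂ) / (t : ℂ)) (Set.Ioc 0 x)) ∧
      (∀ x ≥ (0:ℝ), (f₁ x + A) * (x : ℂ) -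
        ∫ t in Set.Ioc (0:ℝ) x, (f₁ t + A) * (t : ℂ) / (t : ℂ) = E₂ x)) ∧
    (∀ F₁ : ℝ → ℂ,
      (∀ x ≥ (0:ℝ), MeasureTheory.IntegrableOn (fun t : ℝ => F₁ t / (t : ℂ)) (Set.Ioc 0 x)) →
      (∀ x ≥ (0:ℝ), F₁ x - ∫ t in Set.Ioc (0:ℝ) x, F₁ t / (t : ℂ) = E₂ x) →
      ∃ A : ℂ, ∀ x ≥ (0:ℝ), F₁ x = (f₁ x + A) * (x : ℂ)) := by
  have hsq := hasSum_alphaF_div_sq a ha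
  have hC' : Tendsto (fun N : ℕ => ∑ n ∈ Finset.Icc 1 N, alphaF a n / (n : ℂ) ^ 2) atTop
      (𝓝 (2 * C)) := by
    have h2C : 2 * C = ∏' p : Nat.Primes, (1 - gammaF a (p : ℕ) / ((p : ℕ) : ℂ) ^ 2) := by
      rw [hC]
      ring
    rw [h2C]
    exact tendsto_sum_Icc_one_of_hasSum hsq (by simp)
  have hint := integrableOn_sawSeries hconv hsq.summable hf₁
  have hmain : ∀ x ≥ (0 : ℝ), f₁ x * x - ∫ t in Set.Ioc 0 x, f₁ t = E₂ x := by
    intro x hx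
    have hlim := ((hC'.mul_const ((x : ℂ) ^ 2 / 2)).add ((hf₁ x).mul_const (x : ℂ))).sub
      (tendsto_integral_sawPartialSum hconv hsq.summable hf₁ x)
    have hconst : Tendsto (fun _ : ℕ => E₂ x + C * x ^ 2) atTop (𝓝 (E₂ x + C * x ^ 2)) :=
      tendsto_const_nhds
    have h := tendsto_nhds_unique hlim (hconst.congr' (by
      filter_upwards [eventually_ge_atTop ⌊x⌋₊] with N hN
      rw [← average_summatory_eq hE hE₂ hE₂int hx hN, sum_mul_average_eq _ N hx]
      rfl))
    linear_combination h
  have hcancel : ∀ (A : ℂ) (x : ℝ), Set.EqOn (fun t : ℝ => (f₁ t + A) * (t : ℂ) / (t : ℂ))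
      (fun t => f₁ t + A) (Set.Ioc 0 x) := fun A x t ht =>
    mul_div_cancel_right₀ _ (by exact_mod_cast ht.1.ne')
  have hA : ∀ A : ℂ, (∀ x ≥ (0:ℝ), MeasureTheory.IntegrableOn
        (fun t : ℝ => (f₁ t + A) * (t : ℂ) / (t : ℂ)) (Set.Ioc 0 x)) ∧
      (∀ x ≥ (0:ℝ), (f₁ x + A) * (x : ℂ) -
        ∫ t in Set.Ioc (0:ℝ) x, (f₁ t + A) * (t : ℂ) / (t : ℂ) = E₂ x) := by
    intro A
    have hconstInt : ∀ x : ℝ, MeasureTheory.IntegrableOn (fun _ : ℝ => A) (Set.Ioc 0 x) :=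
      fun x => MeasureTheory.integrable_const A
    refine ⟨fun x _ => ?_, fun x hx => ?_⟩
    · rw [MeasureTheory.integrableOn_congr_fun (hcancel A x) measurableSet_Ioc]
      exact (hint x).add (hconstInt x)
    · rw [MeasureTheory.setIntegral_congr_fun measurableSet_Ioc (hcancel A x),
        MeasureTheory.integral_add (hint x) (hconstInt x), ← hmain x hx]
      simp [hx]
      ring
  refine ⟨hA, fun F₁ hF₁int hF₁ => ?_⟩
  obtain ⟨h0int, h0⟩ := hA 0
  have hsub : ∀ t : ℝ, (F₁ t - (f₁ t + 0) * t) / (t : ℂ) =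
      F₁ t / (t : ℂ) - (f₁ t + 0) * (t : ℂ) / (t : ℂ) := fun t => sub_div _ _ _
  obtain ⟨A, hA'⟩ := exists_eq_const_mul_of_eq_integral_div
    (D := fun t => F₁ t - (f₁ t + 0) * t)
    (fun x hx => by
      simp only [hsub]
      exact (hF₁int x hx).sub (h0int x hx))
    (fun x hx => by
      simp only [hsub]
      rw [MeasureTheory.integral_sub (hF₁int x hx) (h0int x hx)]
      linear_combination hF₁ x hx - h0 x hx)
  exact ⟨A, fun x hx => by linear_combination hA' x hx⟩
end
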